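/- Let $\omega \in A_1$, $0 < r < 1$, and suppose $f$ is locally integrable with $\|f\|_{BMO_r(\omega)} := \sup_Q \inf_c \left(\frac{1}{\omega(Q)}\int_Q \left(\frac{|f-c|}{\omega}\right)^r \omega\,dx\right)^{1/r} < \infty$. Then for every cube $Q$ and the minimizing constant $c_Q$, $\frac{1}{\omega(Q)}\int_Q |f(x) - c_Q|\,dx \leq C\,\|f\|_{BMO_r(\omega)}$, where $C$ depends only on $n$, $r$, and $[\omega]_{A_1}$. -/

import Mathlib

open MeasureTheory Real
noncomputable section

abbrev Rn (n : ℕ) := EuclideanSpace ℝ (Fin n)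

def cube {n : ℕ} (c : Rn n) (r : ℝ) : Set (Rn n) := {y | ∀ i, |y i - c i| ≤ r / 2}

def wMeas {n : ℕ} (ω : Rn n → ℝ) (S : Set (Rn n)) : ℝ := ∫ x in S, ω x

def avg {n : ℕ} (f : Rn n → ℝ) (c : Rn n) (r : ℝ) : ℝ := (∫ x in cube c r, f x) / r ^ n

def IsA1 {n : ℕ} (ω : Rn n → ℝ) (A : ℝ) : Prop :=
  (∀ x, 0 < ω x) ∧ LocallyIntegrable ω volume ∧ 1 ≤ A ∧
  ∀ (c : Rn n) (r : ℝ), 0 < r →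
    ∀ᵐ x ∂(volume : Measure (Rn n)), x ∈ cube c r → wMeas ω (cube c r) / r ^ n ≤ A * ω x

def IsAp {n : ℕ} (ω : Rn n → ℝ) (p A : ℝ) : Prop :=
  (∀ x, 0 < ω x) ∧ LocallyIntegrable ω volume ∧
  ∀ (c : Rn n) (r : ℝ), 0 < r →
    (wMeas ω (cube c r) / r ^ n) *
      ((∫ x in cube c r, ω x ^ (-(1 / (p - 1)))) / r ^ n) ^ (p - 1) ≤ A

def IsAinf {n : ℕ} (ω : Rn n → ℝ) : Prop := ∃ p A, 1 < p ∧ IsAp ω p A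

section Helpers
open BoxIntegral Set Filter Topology
open scoped ENNReal

open Classical in
/-- The union of the stopping cubes of generation at most `k` inside `I`. -/
def haltW {n : ℕ} (halted : Box (Fin n) → Prop) : ℕ → Box (Fin n) → Set (Fin n → ℝ)
  | 0, I => if halted I then (I : Set (Fin n → ℝ)) else ∅
  | k + 1, I => if halted I then (I : Set (Fin n → ℝ)) else
      ⋃ s : Set (Fin n), haltW halted k (I.splitCenterBox s)

/-- `I` is a cube with side length `ρ`. -/
def IsCube {n : ℕ} (I : Box (Fin n)) (ρ : ℝ) : Prop :=
  0 < ρ ∧ ∀ i, I.upper i - I.lower i = ρ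

lemma IsCube.split {n : ℕ} {I : Box (Fin n)} {ρ : ℝ} (h : IsCube I ρ) (s : Set (Fin n)) :
    IsCube (I.splitCenterBox s) (ρ / 2) :=
  ⟨half_pos h.1, fun i => by rw [Box.upper_sub_lower_splitCenterBox, h.2 i]⟩

lemma vol_box {n : ℕ} {I : Box (Fin n)} {ρ : ℝ} (h : IsCube I ρ) :
    volume (I : Set (Fin n → ℝ)) = ENNReal.ofReal ρ ^ n := by
  rw [Box.coe_eq_pi, Real.volume_pi_Ioc]
  simp [h.2]

lemma Icc_ball {n : ℕ} {I : Box (Fin n)} {ρ : ℝ} (h : IsCube I ρ) :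
    Box.Icc I = Metric.closedBall (fun i => (I.lower i + I.upper i) / 2) (ρ / 2) := by
  rw [closedBall_pi _ (half_pos h.1).le, Box.Icc_eq_pi]
  congr 1
  ext i x
  have := h.2 i
  simp only [Real.closedBall_eq_Icc, mem_Icc]
  constructor <;> rintro ⟨h1, h2⟩ <;> constructor <;> linarith

lemma vol_split {n : ℕ} {I : Box (Fin n)} {ρ : ℝ} (h : IsCube I ρ) (s : Set (Fin n)) :
    volume (I : Set (Fin n → ℝ)) = 2 ^ n * volume (I.splitCenterBox s : Set (Fin n → ℝ)) := by
  rw [vol_box h, vol_box (h.split s), ← mul_pow]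
  congr 1
  rw [show (2 : ℝ≥0∞) = ENNReal.ofReal 2 by simp, ← ENNReal.ofReal_mul (by norm_num)]
  congr 1; ring

lemma vol_ne_zero {n : ℕ} {I : Box (Fin n)} {ρ : ℝ} (h : IsCube I ρ) :
    volume (I : Set (Fin n → ℝ)) ≠ 0 := by
  rw [vol_box h]
  exact pow_ne_zero _ (by simpa using h.1)

lemma vol_ne_top {n : ℕ} {I : Box (Fin n)} {ρ : ℝ} (h : IsCube I ρ) :
    volume (I : Set (Fin n → ℝ)) ≠ ∞ := by
  rw [vol_box h]
  exact ENNReal.pow_ne_top ENNReal.ofReal_ne_top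

section
variable {n : ℕ} {halted : Box (Fin n) → Prop}

lemma haltW_subset (k : ℕ) : ∀ I, haltW halted k I ⊆ (I : Set (Fin n → ℝ)) := by
  induction k with
  | zero => intro I; simp only [haltW]; split_ifs <;> simp
  | succ k ih =>
    intro I; simp only [haltW]; split_ifs
    · simp
    · exact iUnion_subset fun s => (ih _).trans (Box.splitCenterBox_le I s)

lemma haltW_meas (k : ℕ) : ∀ I, MeasurableSet (haltW halted k I) := by
  induction k with
  | zero => intro I; simp only [haltW]; split_ifs; exacts [I.measurableSet_coe, .empty]
  | succ k ih =>
    intro I; simp only [haltW]; split_ifs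
    · exact I.measurableSet_coe
    · exact MeasurableSet.iUnion fun s => ih _

lemma haltW_step (k : ℕ) : ∀ I, haltW halted k I ⊆ haltW halted (k + 1) I := by
  induction k with
  | zero =>
    intro I
    simp only [haltW]
    by_cases h : halted I <;> simp [h]
  | succ k ih =>
    intro I
    rw [haltW, haltW]
    by_cases h : halted I
    · simp [h]
    · simp only [h, if_false]
      exact iUnion_mono fun s => ih _

lemma haltW_mono (I : Box (Fin n)) : Monotone fun k => haltW halted k I :=
  monotone_nat_of_le_succ fun k => haltW_step k I

/-- Comparison of two measures on the stopped region. -/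
lemma haltW_le (μ ν : Measure (Fin n → ℝ)) (R : Box (Fin n) → Prop)
    (hR : ∀ J, R J → ¬ halted J → ∀ s, R (J.splitCenterBox s))
    (h : ∀ J, R J → halted J → μ J ≤ ν J) (k : ℕ) :
    ∀ I, R I → μ (haltW halted k I) ≤ ν (haltW halted k I) := by
  induction k with
  | zero =>
    intro I hI
    simp only [haltW]
    split_ifs with hs
    · exact h I hI hs
    · simp
  | succ k ih =>
    intro I hI
    simp only [haltW]
    split_ifs with hs
    · exact h I hI hs
    · have hd : Pairwise (Function.onFun Disjoint
          fun s : Set (Fin n) => haltW halted k (I.splitCenterBox s)) := fun s t hst =>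
        (I.disjoint_splitCenterBox hst).mono (haltW_subset _ _) (haltW_subset _ _)
      rw [measure_iUnion hd (fun s => haltW_meas _ _), measure_iUnion hd (fun s => haltW_meas _ _)]
      exact ENNReal.tsum_le_tsum fun s => ih _ (hR I hI hs s)

lemma haltU_le (μ ν : Measure (Fin n → ℝ)) (R : Box (Fin n) → Prop)
    (hR : ∀ J, R J → ¬ halted J → ∀ s, R (J.splitCenterBox s))
    (h : ∀ J, R J → halted J → μ J ≤ ν J) (I : Box (Fin n)) (hI : R I) :
    μ (⋃ k, haltW halted k I) ≤ ν (⋃ k, haltW halted k I) := by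
  rw [(haltW_mono I).measure_iUnion]
  exact iSup_le fun k => (haltW_le μ ν R hR h k I hI).trans
    (measure_mono (subset_iUnion (fun k => haltW halted k I) k))

lemma not_haltW (k : ℕ) : ∀ I ρ x, IsCube I ρ → x ∈ I → x ∉ haltW halted k I →
    ∃ J, IsCube J (ρ / 2 ^ k) ∧ x ∈ J ∧ J ≤ I ∧ ¬ halted J := by
  induction k with
  | zero =>
    intro I ρ x hI hx h
    refine ⟨I, by simpa using hI, hx, le_rfl, fun hs => h ?_⟩
    simpa [haltW, hs] using hx
  | succ k ih =>
    intro I ρ x hI hx h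
    by_cases hs : halted I
    · exact absurd (by simpa [haltW, hs] using hx) h
    · obtain ⟨s, hxs⟩ := Box.exists_mem_splitCenterBox.2 hx
      obtain ⟨J, h1, h2, h3, h4⟩ := ih _ _ x (hI.split s) hxs (fun h' => h (by
        simp only [haltW, hs, if_false]; exact mem_iUnion.2 ⟨s, h'⟩))
      refine ⟨J, ?_, h2, h3.trans (I.splitCenterBox_le s), h4⟩
      convert h1 using 1
      rw [pow_succ]; field_simp

/-- Almost every point outside the stopped region is not in `E`. -/
lemma ae_not_mem {E : Set (Fin n → ℝ)} {lam : ℝ≥0∞} (hlam : lam < 1) (I : Box (Fin n)) (ρ : ℝ)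
    (hI : IsCube I ρ)
    (hst : ∀ J : Box (Fin n), ¬ halted J → volume (E ∩ J) ≤ lam * volume (J : Set (Fin n → ℝ))) :
    ∀ᵐ x, x ∈ I → x ∉ (⋃ k, haltW halted k I) → x ∉ E := by
  have H := ae_imp_of_ae_restrict
    (IsUnifLocDoublingMeasure.ae_tendsto_measure_inter_div (volume : Measure (Fin n → ℝ)) E 1)
  filter_upwards [H] with x hx hxI hxU hxE
  have hx' := hx hxE (ι := ℕ) (l := atTop)
  have hJ : ∀ k, ∃ J, IsCube J (ρ / 2 ^ k) ∧ x ∈ J ∧ J ≤ I ∧ ¬ halted J := fun k =>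
    not_haltW k I ρ x hI hxI (fun h => hxU (mem_iUnion.2 ⟨k, h⟩))
  choose J h1 h2 h3 h4 using hJ
  have hlim := hx' (fun k i => ((J k).lower i + (J k).upper i) / 2) (fun k => ρ / 2 ^ k / 2) ?_ ?_
  · have hle : ∀ k, volume (E ∩ Metric.closedBall
        (fun i => ((J k).lower i + (J k).upper i) / 2) (ρ / 2 ^ k / 2)) /
        volume (Metric.closedBall
        (fun i => ((J k).lower i + (J k).upper i) / 2) (ρ / 2 ^ k / 2)) ≤ lam := by
      intro k
      rw [← Icc_ball (h1 k)]
      rw [← measure_congr (Box.coe_ae_eq_Icc (J k)),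
        ← measure_congr ((ae_eq_refl E).inter (Box.coe_ae_eq_Icc (J k)))]
      exact ENNReal.div_le_of_le_mul (hst _ (h4 k))
    exact absurd (le_of_tendsto' hlim hle) (not_le.2 hlam)
  · refine tendsto_nhdsWithin_iff.2 ⟨?_, Eventually.of_forall fun k => half_pos (h1 k).1⟩
    have : Tendsto (fun k : ℕ => (ρ / 2) * (1 / 2 : ℝ) ^ k) atTop (𝓝 ((ρ / 2) * 0)) :=
      (tendsto_pow_atTop_nhds_zero_of_lt_one (by norm_num) (by norm_num)).const_mul _
    rw [mul_zero] at this
    refine this.congr fun k => ?_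
    rw [one_div, inv_pow]; field_simp
  · refine Eventually.of_forall fun k => ?_
    rw [one_mul, ← Icc_ball (h1 k)]
    exact Box.coe_subset_Icc (h2 k)

end
section
variable {n : ℕ}

/-- One step of the self-improvement argument. -/
lemma jn_step (m : Measure (Fin n → ℝ)) (I0 : Box (Fin n)) (hm : m I0 ≠ ∞)
    (A θ T B : ℝ≥0∞) (hA0 : A ≠ 0) (hA : A ≠ ∞) (hθ : 2 * A = 2 * A * θ + 1) (hθ1 : θ ≤ 1)
    (f : (Fin n → ℝ) → ℝ) (c : Box (Fin n) → ℝ)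
    (hA1 : ∀ I ≤ I0, (∃ ρ, IsCube I ρ) → ∀ F : Set (Fin n → ℝ), MeasurableSet F → F ⊆ I →
      m I * volume F ≤ A * m F * volume (I : Set (Fin n → ℝ)))
    (h2 : ∀ I ≤ I0, (∃ ρ, IsCube I ρ) →
      2 ^ (n + 2) * volume {x | x ∈ I ∧ T * (m I / volume (I : Set (Fin n → ℝ))) < ‖f x - c I‖ₑ} ≤
        volume (I : Set (Fin n → ℝ)))
    (hB : ∀ I ≤ I0, (∃ ρ, IsCube I ρ) → ∫⁻ x in I, ‖f x - c I‖ₑ ≤ B * m I) :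
    ∀ I ≤ I0, (∃ ρ, IsCube I ρ) → ∫⁻ x in I, ‖f x - c I‖ₑ ≤ (2 * T + θ * B) * m I := by
  classical
  intro I hI0 hI
  obtain ⟨ρ, hρ⟩ := hI
  have hmI : m I ≠ ∞ := ne_top_of_le_ne_top hm (measure_mono hI0)
  have hv0 := vol_ne_zero hρ
  have hvt := vol_ne_top hρ
  set a : ℝ≥0∞ := m I / volume (I : Set (Fin n → ℝ)) with ha
  have hav : a * volume (I : Set (Fin n → ℝ)) = m I := ENNReal.div_mul_cancel hv0 hvt
  set E : Set (Fin n → ℝ) := {x | x ∈ I ∧ T * a < ‖f x - c I‖ₑ} with hE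
  have h2E : 2 ^ (n + 2) * volume E ≤ volume (I : Set (Fin n → ℝ)) := h2 I hI0 ⟨ρ, hρ⟩
  set halted : Box (Fin n) → Prop := fun J =>
    volume (J : Set (Fin n → ℝ)) < 2 ^ (n + 1) * volume (E ∩ J) with hhalted
  set R : Box (Fin n) → Prop := fun J =>
    J ≤ I ∧ (∃ ρ, IsCube J ρ) ∧ 2 * volume (E ∩ J) ≤ volume (J : Set (Fin n → ℝ)) with hRdef
  have hR : ∀ J, R J → ¬ halted J → ∀ s, R (J.splitCenterBox s) := by
    rintro J ⟨hJI, ⟨σ, hσ⟩, _⟩ hs s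
    refine ⟨(J.splitCenterBox_le s).trans hJI, ⟨_, hσ.split s⟩, ?_⟩
    have h1 : 2 ^ (n + 1) * volume (E ∩ J) ≤ volume (J : Set (Fin n → ℝ)) := not_lt.1 hs
    rw [vol_split hσ s, pow_succ, mul_assoc] at h1
    have h3 := (ENNReal.mul_le_mul_iff_right (by positivity) (by simp)).1 h1
    refine le_trans ?_ h3
    gcongr
    exact J.splitCenterBox_le s
  have hone : (1 : ℝ≥0∞) ≤ 2 ^ n := one_le_pow₀ (by norm_num)
  have hRI : R I := by
    refine ⟨le_rfl, ⟨ρ, hρ⟩, le_trans ?_ h2E⟩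
    rw [pow_add]
    gcongr
    · calc (2 : ℝ≥0∞) ≤ 1 * 2 ^ 2 := by norm_num
        _ ≤ _ := by gcongr
    · exact inter_subset_left
  set U := ⋃ k, haltW halted k I with hU
  have hUm : MeasurableSet U := MeasurableSet.iUnion fun k => haltW_meas k I
  have hUI : U ⊆ I := iUnion_subset fun k => haltW_subset k I
  -- the stopped region is at most half of the cube
  have hU1 : 2 * volume U ≤ volume (I : Set (Fin n → ℝ)) := by
    have h3 := haltU_le (halted := halted) volume ((2 ^ (n + 1) : ℝ≥0∞) • volume.restrict E) R hR (by
      intro J hJ hs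
      simp only [Measure.smul_apply, smul_eq_mul]
      rw [Measure.restrict_apply J.measurableSet_coe, inter_comm]
      exact hs.le) I hRI
    simp only [Measure.smul_apply, smul_eq_mul] at h3
    calc 2 * volume U ≤ 2 * (2 ^ (n + 1) * volume.restrict E U) := by gcongr
      _ ≤ 2 * (2 ^ (n + 1) * volume E) := by
          gcongr 2 * (2 ^ (n + 1) * ?_)
          calc volume.restrict E U ≤ volume.restrict E univ := measure_mono (subset_univ _)
            _ = volume E := by simp
      _ = 2 ^ (n + 2) * volume E := by ring
      _ ≤ _ := h2E
  -- bound on the stopped region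
  have hU2 : ∫⁻ x in U, ‖f x - c I‖ₑ ≤ (B + T) * m U + T * a * volume U := by
    have h3 := haltU_le (halted := halted) (volume.withDensity fun x => ‖f x - c I‖ₑ)
      ((B + T) • m + (T * a) • volume) R hR (by
      rintro J ⟨hJI, ⟨σ, hσ⟩, hJ⟩ hs
      rw [withDensity_apply _ J.measurableSet_coe]
      simp only [Measure.add_apply, Measure.smul_apply, smul_eq_mul]
      have hJv0 := vol_ne_zero hσ
      have hJvt := vol_ne_top hσ
      have hJ2 := h2 J (hJI.trans hI0) ⟨σ, hσ⟩
      set b : ℝ≥0∞ := m J / volume (J : Set (Fin n → ℝ)) with hb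
      have hbv : b * volume (J : Set (Fin n → ℝ)) = m J := ENNReal.div_mul_cancel hJv0 hJvt
      set E' : Set (Fin n → ℝ) := {x | x ∈ J ∧ T * b < ‖f x - c J‖ₑ} with hE'
      have h4 : 4 * volume E' ≤ volume (J : Set (Fin n → ℝ)) := by
        refine le_trans ?_ hJ2
        rw [pow_add]
        gcongr
        calc (4 : ℝ≥0∞) = 1 * 2 ^ 2 := by norm_num
          _ ≤ _ := by gcongr
      have hex : ∃ x ∈ J, x ∉ E ∧ x ∉ E' := by
        by_contra! hcon
        have hsub : (J : Set (Fin n → ℝ)) ⊆ (E ∩ J) ∪ E' := by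
          intro x hx
          by_cases hxE : x ∈ E
          · exact Or.inl ⟨hxE, hx⟩
          · exact Or.inr (hcon x hx hxE)
        have h5 := (measure_mono hsub).trans (measure_union_le (μ := volume) _ _)
        have h6 : 4 * volume (J : Set (Fin n → ℝ)) ≤ 3 * volume (J : Set (Fin n → ℝ)) := by
          calc 4 * volume (J : Set (Fin n → ℝ)) ≤ 4 * (volume (E ∩ J) + volume E') := by gcongr
            _ = 2 * (2 * volume (E ∩ J)) + 4 * volume E' := by ring
            _ ≤ 2 * volume (J : Set (Fin n → ℝ)) + volume (J : Set (Fin n → ℝ)) := by gcongr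
            _ = _ := by ring
        have h7 := (ENNReal.mul_le_mul_iff_left hJv0 hJvt).1 h6
        norm_num at h7
      obtain ⟨x, hxJ, hxE, hxE'⟩ := hex
      have h8 : ‖f x - c I‖ₑ ≤ T * a := by
        by_contra hcon
        exact hxE ⟨hJI hxJ, not_le.1 hcon⟩
      have h9 : ‖f x - c J‖ₑ ≤ T * b := by
        by_contra hcon
        exact hxE' ⟨hxJ, not_le.1 hcon⟩
      have h10 : ‖c J - c I‖ₑ ≤ T * a + T * b := by
        calc ‖c J - c I‖ₑ = ‖(f x - c I) - (f x - c J)‖ₑ := by congr 1; ring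
          _ ≤ ‖f x - c I‖ₑ + ‖f x - c J‖ₑ := enorm_sub_le
          _ ≤ _ := by gcongr
      calc ∫⁻ y in J, ‖f y - c I‖ₑ ≤ ∫⁻ y in J, (‖f y - c J‖ₑ + ‖c J - c I‖ₑ) := by
            refine lintegral_mono fun y => ?_
            calc ‖f y - c I‖ₑ = ‖(f y - c J) + (c J - c I)‖ₑ := by congr 1; ring
              _ ≤ _ := enorm_add_le _ _
        _ = (∫⁻ y in J, ‖f y - c J‖ₑ) + ‖c J - c I‖ₑ * volume (J : Set (Fin n → ℝ)) := by
            rw [lintegral_add_right _ measurable_const, setLIntegral_const]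
        _ ≤ B * m J + (T * a + T * b) * volume (J : Set (Fin n → ℝ)) := by
            gcongr
            exact hB J (hJI.trans hI0) ⟨σ, hσ⟩
        _ = B * m J + T * a * volume (J : Set (Fin n → ℝ)) +
              T * (b * volume (J : Set (Fin n → ℝ))) := by ring
        _ = (B + T) * m J + T * a * volume (J : Set (Fin n → ℝ)) := by rw [hbv]; ring) I hRI
    rw [withDensity_apply _ hUm] at h3
    simpa only [Measure.add_apply, Measure.smul_apply, smul_eq_mul] using h3
  -- bound off the stopped region
  have hU3 : ∫⁻ x in (I : Set (Fin n → ℝ)) \ U, ‖f x - c I‖ₑ ≤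
      T * a * volume ((I : Set (Fin n → ℝ)) \ U) := by
    rw [← setLIntegral_const]
    refine lintegral_mono_ae ?_
    change ∀ᵐ x ∂_, _ ≤ _
    rw [ae_restrict_iff' (I.measurableSet_coe.diff hUm)]
    have := ae_not_mem (halted := halted) (E := E) (lam := 2⁻¹) (by norm_num) I ρ hρ (by
      intro J hs
      have h1 : 2 ^ (n + 1) * volume (E ∩ J) ≤ volume (J : Set (Fin n → ℝ)) := not_lt.1 hs
      have h3 : 2 * volume (E ∩ J) ≤ volume (J : Set (Fin n → ℝ)) := by
        refine le_trans ?_ h1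
        gcongr
        calc (2 : ℝ≥0∞) = 1 * 2 := by norm_num
          _ ≤ 2 ^ n * 2 := by gcongr
          _ = _ := by rw [pow_succ]
      calc volume (E ∩ J) = 2⁻¹ * (2 * volume (E ∩ J)) := by
            rw [← mul_assoc, ENNReal.inv_mul_cancel (by norm_num) (by norm_num), one_mul]
        _ ≤ _ := by gcongr)
    filter_upwards [this] with x hx hxI
    have := hx hxI.1 hxI.2
    by_contra hcon
    exact this ⟨hxI.1, not_le.1 hcon⟩
  have hsplitv : volume U + volume ((I : Set (Fin n → ℝ)) \ U) = volume (I : Set (Fin n → ℝ)) := by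
    have := measure_inter_add_sdiff (μ := volume) (I : Set (Fin n → ℝ)) hUm
    rwa [inter_eq_self_of_subset_right hUI] at this
  have hsplitm : m U + m ((I : Set (Fin n → ℝ)) \ U) = m (I : Set (Fin n → ℝ)) := by
    have := measure_inter_add_sdiff (μ := m) (I : Set (Fin n → ℝ)) hUm
    rwa [inter_eq_self_of_subset_right hUI] at this
  have hUt : volume U ≠ ∞ := ne_top_of_le_ne_top hvt (measure_mono hUI)
  have hhalf : volume (I : Set (Fin n → ℝ)) ≤ 2 * volume ((I : Set (Fin n → ℝ)) \ U) := by
    have : 2 * volume U + volume (I : Set (Fin n → ℝ)) ≤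
        2 * volume U + 2 * volume ((I : Set (Fin n → ℝ)) \ U) := by
      calc _ ≤ volume (I : Set (Fin n → ℝ)) + volume (I : Set (Fin n → ℝ)) := by gcongr
        _ = 2 * (volume U + volume ((I : Set (Fin n → ℝ)) \ U)) := by rw [hsplitv]; ring
        _ = _ := by ring
    exact (ENNReal.add_le_add_iff_left (ENNReal.mul_ne_top (by simp) hUt)).1 this
  have hmD : m I ≤ 2 * A * m ((I : Set (Fin n → ℝ)) \ U) := by
    have h3 := hA1 I hI0 ⟨ρ, hρ⟩ ((I : Set (Fin n → ℝ)) \ U) (I.measurableSet_coe.diff hUm)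
      sdiff_subset
    have h4 : m I * volume (I : Set (Fin n → ℝ)) ≤
        2 * A * m ((I : Set (Fin n → ℝ)) \ U) * volume (I : Set (Fin n → ℝ)) := by
      calc _ ≤ m I * (2 * volume ((I : Set (Fin n → ℝ)) \ U)) := by gcongr
        _ = 2 * (m I * volume ((I : Set (Fin n → ℝ)) \ U)) := by ring
        _ ≤ 2 * (A * m ((I : Set (Fin n → ℝ)) \ U) * volume (I : Set (Fin n → ℝ))) := by gcongr
        _ = _ := by ring
    exact (ENNReal.mul_le_mul_iff_left hv0 hvt).1 h4
  have hmU : m U ≤ θ * m I := by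
    have h3 : 2 * A * m U + m I ≤ 2 * A * (θ * m I) + m I := by
      calc 2 * A * m U + m I ≤ 2 * A * m U + 2 * A * m ((I : Set (Fin n → ℝ)) \ U) := by gcongr
        _ = 2 * A * m I := by rw [← mul_add, hsplitm]
        _ = (2 * A * θ + 1) * m I := by rw [← hθ]
        _ = _ := by ring
    have h4 := (ENNReal.add_le_add_iff_right hmI).1 h3
    exact (ENNReal.mul_le_mul_iff_right (by simp [hA0]) (ENNReal.mul_ne_top (by simp) hA)).1 h4
  calc ∫⁻ x in I, ‖f x - c I‖ₑ
      = (∫⁻ x in U, ‖f x - c I‖ₑ) + ∫⁻ x in (I : Set (Fin n → ℝ)) \ U, ‖f x - c I‖ₑ := by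
        have := lintegral_inter_add_sdiff (μ := volume) (fun x => ‖f x - c I‖ₑ)
          (I : Set (Fin n → ℝ)) hUm
        rw [inter_eq_self_of_subset_right hUI] at this
        exact this.symm
    _ ≤ ((B + T) * m U + T * a * volume U) + T * a * volume ((I : Set (Fin n → ℝ)) \ U) := by
        gcongr
    _ = (B + T) * m U + T * (a * (volume U + volume ((I : Set (Fin n → ℝ)) \ U))) := by ring
    _ = B * m U + T * m U + T * m I := by rw [hsplitv, hav]; ring
    _ ≤ B * (θ * m I) + T * m I + T * m I := by
        gcongr
    _ = _ := by ring

/-- Iterating the step, for bounded oscillation. -/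
lemma jn_iter (m : Measure (Fin n → ℝ)) (I0 : Box (Fin n)) (hm : m I0 ≠ ∞)
    (A θ T B : ℝ≥0∞) (hA0 : A ≠ 0) (hA : A ≠ ∞) (hθ : 2 * A = 2 * A * θ + 1) (hθ1 : θ < 1)
    (hBt : B ≠ ∞)
    (f : (Fin n → ℝ) → ℝ) (c : Box (Fin n) → ℝ)
    (hA1 : ∀ I ≤ I0, (∃ ρ, IsCube I ρ) → ∀ F : Set (Fin n → ℝ), MeasurableSet F → F ⊆ I →
      m I * volume F ≤ A * m F * volume (I : Set (Fin n → ℝ)))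
    (h2 : ∀ I ≤ I0, (∃ ρ, IsCube I ρ) →
      2 ^ (n + 2) * volume {x | x ∈ I ∧ T * (m I / volume (I : Set (Fin n → ℝ))) < ‖f x - c I‖ₑ} ≤
        volume (I : Set (Fin n → ℝ)))
    (hB : ∀ I ≤ I0, (∃ ρ, IsCube I ρ) → ∫⁻ x in I, ‖f x - c I‖ₑ ≤ B * m I)
    (h0 : ∃ ρ, IsCube I0 ρ) :
    ∫⁻ x in I0, ‖f x - c I0‖ₑ ≤ 4 * A * T * m I0 := by
  have key : ∀ k : ℕ, ∀ I ≤ I0, (∃ ρ, IsCube I ρ) →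
      ∫⁻ x in I, ‖f x - c I‖ₑ ≤ (4 * A * T + θ ^ k * B) * m I := by
    intro k
    induction k with
    | zero =>
      intro I hI hc
      refine (hB I hI hc).trans ?_
      gcongr
      simp
    | succ k ih =>
      intro I hI hc
      refine (jn_step m I0 hm A θ T _ hA0 hA hθ hθ1.le f c hA1 h2 ih I hI hc).trans ?_
      refine le_of_eq ?_
      congr 1
      calc 2 * T + θ * (4 * A * T + θ ^ k * B) = 2 * T * (2 * A * θ + 1) + θ ^ (k + 1) * B := by
            ring
        _ = _ := by rw [← hθ]; ring
  have hlim : Tendsto (fun k : ℕ => (4 * A * T + θ ^ k * B) * m I0) atTop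
      (𝓝 ((4 * A * T + 0 * B) * m I0)) := by
    refine ENNReal.Tendsto.mul_const ?_ (Or.inr hm)
    refine Tendsto.add tendsto_const_nhds ?_
    exact ENNReal.Tendsto.mul_const (ENNReal.tendsto_pow_atTop_nhds_zero_of_lt_one hθ1) (Or.inr hBt)
  have := ge_of_tendsto' hlim fun k => key k I0 le_rfl h0
  simpa using this

/-- Truncation. -/
def trunc (M x : ℝ) : ℝ := max (-M) (min x M)

lemma trunc_lip (M x y : ℝ) : |trunc M x - trunc M y| ≤ |x - y| := by
  unfold trunc
  exact (abs_max_sub_max_le_max _ _ _ _ |>.trans (by simp)) |>.trans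
    (abs_min_sub_min_le_max x M y M |>.trans (by simp))

lemma trunc_bdd {M : ℝ} (hM : 0 ≤ M) (x : ℝ) : |trunc M x| ≤ M := by
  unfold trunc
  rw [abs_le]
  exact ⟨le_max_left _ _, max_le (by linarith) (min_le_right _ _)⟩

lemma trunc_eq {M x : ℝ} (h : |x| ≤ M) : trunc M x = x := by
  unfold trunc
  rw [abs_le] at h
  rw [min_eq_left h.2, max_eq_right h.1]

lemma jn_main (m : Measure (Fin n → ℝ)) (I0 : Box (Fin n)) (hm : m I0 ≠ ∞) (hm0 : m I0 ≠ 0)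
    (A θ T : ℝ≥0∞) (hA0 : A ≠ 0) (hA : A ≠ ∞) (hθ : 2 * A = 2 * A * θ + 1) (hθ1 : θ < 1)
    (f : (Fin n → ℝ) → ℝ) (hf : AEMeasurable f volume) (c : Box (Fin n) → ℝ)
    (hA1 : ∀ I ≤ I0, (∃ ρ, IsCube I ρ) → ∀ F : Set (Fin n → ℝ), MeasurableSet F → F ⊆ I →
      m I * volume F ≤ A * m F * volume (I : Set (Fin n → ℝ)))
    (h2 : ∀ I ≤ I0, (∃ ρ, IsCube I ρ) →
      2 ^ (n + 2) * volume {x | x ∈ I ∧ T * (m I / volume (I : Set (Fin n → ℝ))) < ‖f x - c I‖ₑ} ≤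
        volume (I : Set (Fin n → ℝ)))
    (h0 : ∃ ρ, IsCube I0 ρ) :
    ∫⁻ x in I0, ‖f x - c I0‖ₑ ≤ 4 * A * T * m I0 := by
  have key : ∀ M : ℕ, ∫⁻ x in I0, ‖trunc M (f x) - trunc M (c I0)‖ₑ ≤ 4 * A * T * m I0 := by
    intro M
    obtain ⟨ρ, hρ⟩ := h0
    have hvt := vol_ne_top hρ
    refine jn_iter m I0 hm A θ T
      (ENNReal.ofReal (2 * M) * (A * volume (I0 : Set (Fin n → ℝ)) / m I0)) hA0 hA hθ hθ1
      (ENNReal.mul_ne_top ENNReal.ofReal_ne_top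
        (ENNReal.div_ne_top (ENNReal.mul_ne_top hA hvt) hm0))
      (fun x => trunc M (f x)) (fun I => trunc M (c I)) hA1 ?_ ?_ ⟨ρ, hρ⟩
    · intro I hI hc
      refine le_trans ?_ (h2 I hI hc)
      gcongr 2 ^ (n + 2) * volume ?_
      rintro x ⟨hx, hlt⟩
      refine ⟨hx, hlt.trans_le ?_⟩
      rw [enorm_le_iff_norm_le, Real.norm_eq_abs, Real.norm_eq_abs]
      exact trunc_lip _ _ _
    · intro I hI hc
      have h3 := hA1 I0 le_rfl ⟨ρ, hρ⟩ I I.measurableSet_coe hI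
      have h4 : volume (I : Set (Fin n → ℝ)) ≤ A * volume (I0 : Set (Fin n → ℝ)) / m I0 * m I := by
        rw [← ENNReal.mul_div_right_comm, ENNReal.le_div_iff_mul_le (Or.inl hm0) (Or.inl hm)]
        calc _ = _ := mul_comm _ _
          _ ≤ _ := h3
          _ = _ := by ring
      calc ∫⁻ x in I, ‖trunc M (f x) - trunc M (c I)‖ₑ
          ≤ ∫⁻ x in I, ENNReal.ofReal (2 * M) := by
            refine lintegral_mono fun x => ?_
            rw [Real.enorm_eq_ofReal_abs]
            refine ENNReal.ofReal_le_ofReal ?_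
            have h5 := trunc_bdd (Nat.cast_nonneg (α := ℝ) M) (f x)
            have h6 := trunc_bdd (Nat.cast_nonneg (α := ℝ) M) (c I)
            have := abs_sub (trunc M (f x)) (trunc M (c I))
            linarith
        _ = ENNReal.ofReal (2 * M) * volume (I : Set (Fin n → ℝ)) := setLIntegral_const _ _
        _ ≤ _ := by rw [mul_assoc]; gcongr
  have hpt : ∀ x, liminf (fun M : ℕ => ‖trunc M (f x) - trunc M (c I0)‖ₑ) atTop = ‖f x - c I0‖ₑ := by
    intro x
    refine Tendsto.liminf_eq (tendsto_const_nhds.congr' ?_)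
    filter_upwards [eventually_ge_atTop (⌈|f x|⌉₊), eventually_ge_atTop (⌈|c I0|⌉₊)] with M h1 h2
    rw [trunc_eq (Nat.ceil_le.1 h1), trunc_eq (Nat.ceil_le.1 h2)]
  calc ∫⁻ x in I0, ‖f x - c I0‖ₑ
      = ∫⁻ x in I0, liminf (fun M : ℕ => ‖trunc M (f x) - trunc M (c I0)‖ₑ) atTop := by
        simp_rw [hpt]
    _ ≤ liminf (fun M : ℕ => ∫⁻ x in I0, ‖trunc M (f x) - trunc M (c I0)‖ₑ) atTop := by
        refine lintegral_liminf_le' fun M => ?_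
        have : AEMeasurable f (volume.restrict (I0 : Set (Fin n → ℝ))) := hf.restrict
        unfold trunc
        fun_prop
    _ ≤ liminf (fun _ : ℕ => 4 * A * T * m I0) atTop :=
        liminf_le_liminf (Eventually.of_forall key)
    _ = _ := by simp

end
section
variable {n : ℕ}

lemma cheb_int {r : ℝ} (hr0 : 0 < r) (hr1 : r < 1) (I : Box (Fin n))
    (Ω F : (Fin n → ℝ) → ℝ) (k : ℝ) (hpos : ∀ x, 0 < Ω x)
    (hΩ : IntegrableOn Ω I) (hF : IntegrableOn F I) :
    IntegrableOn (fun x => (|F x - k| / Ω x) ^ r * Ω x) I := by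
  have hk : IntegrableOn (fun x => F x - k) (I : Set (Fin n → ℝ)) :=
    hF.sub (integrableOn_const (I.measure_coe_lt_top volume).ne)
  refine Integrable.mono' (hk.abs.add hΩ) ?_ (ae_of_all _ fun x => ?_)
  · have h1 := hΩ.aemeasurable
    have h2 := hF.aemeasurable
    have h3 : AEMeasurable (fun x => |F x - k| / Ω x) (volume.restrict (I : Set (Fin n → ℝ))) := by
      have := hk.abs.aemeasurable
      exact this.div h1
    exact ((h3.pow_const r).mul h1).aestronglyMeasurable
  · have hp := hpos x
    have ht : 0 ≤ |F x - k| / Ω x := by positivity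
    have h1 : (|F x - k| / Ω x) ^ r ≤ |F x - k| / Ω x + 1 := by
      rcases le_total (|F x - k| / Ω x) 1 with h | h
      · have := Real.rpow_le_one ht h hr0.le
        linarith
      · have := Real.rpow_le_rpow_of_exponent_le h hr1.le
        rw [Real.rpow_one] at this
        linarith
    rw [Real.norm_of_nonneg (by positivity)]
    calc _ ≤ (|F x - k| / Ω x + 1) * Ω x := by gcongr
      _ = _ := by simp only [Pi.add_apply]; field_simp

lemma m_box (I : Box (Fin n)) (Ω : (Fin n → ℝ) → ℝ) (hpos : ∀ x, 0 < Ω x)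
    (hΩ : IntegrableOn Ω I) :
    (volume.withDensity fun x => ENNReal.ofReal (Ω x)) (I : Set (Fin n → ℝ)) =
      ENNReal.ofReal (∫ x in I, Ω x) := by
  rw [withDensity_apply _ I.measurableSet_coe,
    ofReal_integral_eq_lintegral_ofReal hΩ (ae_of_all _ fun x => (hpos x).le)]

lemma int_pos {I : Box (Fin n)} {ρ : ℝ} (hI : IsCube I ρ) (Ω : (Fin n → ℝ) → ℝ)
    (hpos : ∀ x, 0 < Ω x) (hΩ : IntegrableOn Ω I) : 0 < ∫ x in I, Ω x := by
  rw [setIntegral_pos_iff_support_of_nonneg_ae (ae_of_all _ fun x => (hpos x).le) hΩ]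
  have : Function.support Ω = univ := by
    ext x; simp [(hpos x).ne']
  rw [this, univ_inter]
  exact pos_iff_ne_zero.2 (vol_ne_zero hI)

lemma vol_box' {I : Box (Fin n)} {ρ : ℝ} (h : IsCube I ρ) :
    volume (I : Set (Fin n → ℝ)) = ENNReal.ofReal (ρ ^ n) := by
  rw [vol_box h, ENNReal.ofReal_pow h.1.le]

lemma cheb {r A τ N ρ : ℝ} (hr0 : 0 < r) (hr1 : r < 1) (hA : 1 ≤ A) (hN : 0 < N) (hτ0 : 0 < τ)
    (hτ : 2 ^ (n + 2) * A ≤ τ ^ r)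
    (I : Box (Fin n)) (hI : IsCube I ρ) (Ω F : (Fin n → ℝ) → ℝ) (k : ℝ) (hpos : ∀ x, 0 < Ω x)
    (hΩ : IntegrableOn Ω I) (hF : IntegrableOn F I)
    (hA1 : ∀ᵐ x, x ∈ I → (∫ x in I, Ω x) / ρ ^ n ≤ A * Ω x)
    (hN' : ∫ x in I, (|F x - k| / Ω x) ^ r * Ω x ≤ N ^ r * ∫ x in I, Ω x) :
    2 ^ (n + 2) * volume {x | x ∈ I ∧ ENNReal.ofReal (τ * N) *
      ((volume.withDensity fun x => ENNReal.ofReal (Ω x)) (I : Set (Fin n → ℝ)) /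
        volume (I : Set (Fin n → ℝ))) < ‖F x - k‖ₑ} ≤ volume (I : Set (Fin n → ℝ)) := by
  have hw := int_pos hI Ω hpos hΩ
  have hρ : 0 < ρ ^ n := pow_pos hI.1 n
  rw [m_box I Ω hpos hΩ, vol_box' hI, ← ENNReal.ofReal_div_of_pos hρ]
  set a := (∫ x in I, Ω x) / ρ ^ n with ha
  have ha0 : 0 < a := div_pos hw hρ
  have haw : a * ρ ^ n = ∫ x in I, Ω x := div_mul_cancel₀ _ hρ.ne'
  set h : (Fin n → ℝ) → ℝ := fun x => (|F x - k| / Ω x) ^ r * Ω x with hh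
  have hhInt : IntegrableOn h I := cheb_int hr0 hr1 I Ω F k hpos hΩ hF
  set ε : ℝ := 2 ^ (n + 2) * N ^ r * a with hε
  have hNr : 0 < N ^ r := Real.rpow_pos_of_pos hN r
  have hmk := mul_meas_ge_le_integral_of_nonneg (μ := volume.restrict (I : Set (Fin n → ℝ)))
    (f := h) (ae_of_all _ fun x => by have := hpos x; simp only [hh, Pi.zero_apply]; positivity)
    hhInt ε
  set v := (volume.restrict (I : Set (Fin n → ℝ))).real {x | ε ≤ h x} with hv
  have hv1 : 2 ^ (n + 2) * v ≤ ρ ^ n := by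
    have h1 : (N ^ r * a) * (2 ^ (n + 2) * v) ≤ (N ^ r * a) * ρ ^ n := by
      calc _ = ε * v := by rw [hε]; ring
        _ ≤ _ := hmk.trans hN'
        _ = _ := by rw [← haw]; ring
    exact le_of_mul_le_mul_left h1 (by positivity)
  have hsub : volume {x | x ∈ I ∧ ENNReal.ofReal (τ * N) * ENNReal.ofReal a < ‖F x - k‖ₑ} ≤
      (volume.restrict (I : Set (Fin n → ℝ))) {x | ε ≤ h x} := by
    rw [Measure.restrict_apply' I.measurableSet_coe]
    refine measure_mono_ae ?_
    filter_upwards [hA1] with x hx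
    rintro ⟨hxI, hlt⟩
    refine ⟨?_, hxI⟩
    have hx1 := hx hxI
    have hp := hpos x
    rw [← ENNReal.ofReal_mul (by positivity), Real.enorm_eq_ofReal_abs,
      ENNReal.ofReal_lt_ofReal_iff_of_nonneg (by positivity)] at hlt
    change ε ≤ (|F x - k| / Ω x) ^ r * Ω x
    have haA : a / A ≤ Ω x := by rw [div_le_iff₀ (by linarith)]; linarith
    have h1 : a / A ≤ (a / Ω x) ^ r * Ω x := by
      rcases le_total a (Ω x) with h | h
      · have h3 : a / Ω x ≤ (a / Ω x) ^ r := by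
          have := Real.rpow_le_rpow_of_exponent_ge (x := a / Ω x) (by positivity)
            ((div_le_one hp).2 h) hr1.le
          rwa [Real.rpow_one] at this
        calc a / A ≤ a := div_le_self ha0.le hA
          _ = a / Ω x * Ω x := by field_simp
          _ ≤ _ := by gcongr
      · have h3 : 1 ≤ (a / Ω x) ^ r := Real.one_le_rpow ((one_le_div hp).2 h) hr0.le
        calc a / A ≤ 1 * Ω x := by linarith
          _ ≤ _ := by gcongr
    calc ε = (2 ^ (n + 2) * A) * N ^ r * (a / A) := by rw [hε]; field_simp
      _ ≤ τ ^ r * N ^ r * ((a / Ω x) ^ r * Ω x) := by gcongr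
      _ = (τ * N * (a / Ω x)) ^ r * Ω x := by
          rw [Real.mul_rpow (by positivity) (by positivity), Real.mul_rpow hτ0.le hN.le]; ring
      _ = (τ * N * a / Ω x) ^ r * Ω x := by rw [mul_div_assoc]
      _ ≤ _ := by gcongr
  have hfin : (volume.restrict (I : Set (Fin n → ℝ))) {x | ε ≤ h x} = ENNReal.ofReal v := by
    rw [hv]
    refine (ofReal_measureReal ?_).symm
    rw [Measure.restrict_apply' I.measurableSet_coe]
    exact ne_top_of_le_ne_top (vol_ne_top hI) (measure_mono inter_subset_right)
  rw [hfin] at hsub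
  calc _ ≤ 2 ^ (n + 2) * ENNReal.ofReal v := by gcongr
    _ = ENNReal.ofReal (2 ^ (n + 2) * v) := by
        rw [ENNReal.ofReal_mul (by positivity), ENNReal.ofReal_pow (by norm_num)]; simp
    _ ≤ _ := ENNReal.ofReal_le_ofReal hv1

lemma a1_sets {A ρ : ℝ} (hA : 1 ≤ A)
    (I : Box (Fin n)) (hI : IsCube I ρ) (Ω : (Fin n → ℝ) → ℝ) (hpos : ∀ x, 0 < Ω x)
    (hΩ : IntegrableOn Ω I)
    (hA1 : ∀ᵐ x, x ∈ I → (∫ x in I, Ω x) / ρ ^ n ≤ A * Ω x)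
    (F : Set (Fin n → ℝ)) (hF : MeasurableSet F) (hFI : F ⊆ I) :
    (volume.withDensity fun x => ENNReal.ofReal (Ω x)) (I : Set (Fin n → ℝ)) * volume F ≤
      ENNReal.ofReal A * (volume.withDensity fun x => ENNReal.ofReal (Ω x)) F *
        volume (I : Set (Fin n → ℝ)) := by
  have hρ : 0 < ρ ^ n := pow_pos hI.1 n
  have hw := int_pos hI Ω hpos hΩ
  rw [m_box I Ω hpos hΩ, vol_box' hI, withDensity_apply _ hF]
  set a := (∫ x in I, Ω x) / ρ ^ n with ha
  have ha0 : 0 < a := div_pos hw hρ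
  have haw : a * ρ ^ n = ∫ x in I, Ω x := div_mul_cancel₀ _ hρ.ne'
  have h1 : ENNReal.ofReal (a / A) * volume F ≤ ∫⁻ x in F, ENNReal.ofReal (Ω x) := by
    rw [← setLIntegral_const]
    refine lintegral_mono_ae ?_
    change ∀ᵐ x ∂_, _ ≤ _
    rw [ae_restrict_iff' hF]
    filter_upwards [hA1] with x hx hxF
    refine ENNReal.ofReal_le_ofReal ?_
    rw [div_le_iff₀ (by linarith)]
    linarith [hx (hFI hxF)]
  calc _ = ENNReal.ofReal A * (ENNReal.ofReal (a / A) * volume F) * ENNReal.ofReal (ρ ^ n) := by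
        have e : ENNReal.ofReal a = ENNReal.ofReal A * ENNReal.ofReal (a / A) := by
          rw [← ENNReal.ofReal_mul (by linarith)]
          congr 1
          field_simp
        rw [← haw, ENNReal.ofReal_mul ha0.le, e]
        ring
    _ ≤ _ := by gcongr

/-- Transfer: the preimage of a Euclidean-space cube is the closed box. -/
lemma preimage_cube {I : Box (Fin n)} {ρ : ℝ} (hI : IsCube I ρ) :
    (WithLp.toLp 2 : (Fin n → ℝ) → Rn n) ⁻¹'
      cube (WithLp.toLp 2 fun i => (I.lower i + I.upper i) / 2) ρ = Box.Icc I := by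
  rw [Icc_ball hI, closedBall_pi _ (half_pos hI.1).le]
  ext x
  simp [cube, Real.dist_eq]

lemma int_cube {I : Box (Fin n)} {ρ : ℝ} (hI : IsCube I ρ) (g : Rn n → ℝ) :
    ∫ x in cube (WithLp.toLp 2 fun i => (I.lower i + I.upper i) / 2) ρ, g x =
      ∫ x in I, g (WithLp.toLp 2 x) := by
  rw [setIntegral_congr_set (Box.coe_ae_eq_Icc I), ← preimage_cube hI]
  exact ((PiLp.volume_preserving_toLp (Fin n)).setIntegral_preimage_emb
    (MeasurableEquiv.toLp 2 (Fin n → ℝ)).measurableEmbedding g _).symm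

lemma loc_int (g : Rn n → ℝ) (hg : LocallyIntegrable g volume) (I : Box (Fin n)) :
    IntegrableOn (fun x => g (WithLp.toLp 2 x)) (I : Set (Fin n → ℝ)) := by
  refine IntegrableOn.mono_set ?_ Box.coe_subset_Icc
  have hK : IsCompact ((WithLp.toLp 2 : (Fin n → ℝ) → Rn n) '' (Box.Icc I)) :=
    I.isCompact_Icc.image (PiLp.continuous_toLp 2 _)
  have h1 := hg.integrableOn_isCompact hK
  have h2 := ((PiLp.volume_preserving_toLp (Fin n)).integrableOn_comp_preimage
    (MeasurableEquiv.toLp 2 (Fin n → ℝ)).measurableEmbedding (f := g)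
    (s := (WithLp.toLp 2 : (Fin n → ℝ) → Rn n) '' (Box.Icc I))).2 h1
  exact h2.mono_set (subset_preimage_image _ _)

end

lemma stmt6_pos (n : ℕ) (r A : ℝ) (hr0 : 0 < r) (hr1 : r < 1) (hA : 1 ≤ A) (τ : ℝ) (hτ0 : 0 < τ)
    (hτ : 2 ^ (n + 2) * A ≤ τ ^ r) (ω f : Rn n → ℝ) (cQ : Rn n → ℝ → ℝ) (N : ℝ)
    (hω : IsA1 ω A) (hf : LocallyIntegrable f volume) (hN : 0 < N)
    (hosc : ∀ (c : Rn n) (ρ : ℝ), 0 < ρ →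
      (∫ x in cube c ρ, (|f x - cQ c ρ| / ω x) ^ r * ω x) ≤ N ^ r * wMeas ω (cube c ρ))
    (c : Rn n) (ρ : ℝ) (hρ : 0 < ρ) :
    (∫ x in cube c ρ, |f x - cQ c ρ|) ≤ (4 * A * τ) * N * wMeas ω (cube c ρ) := by
  classical
  obtain ⟨hpos, hloc, -, hA1⟩ := hω
  let I0 : Box (Fin n) := ⟨fun i => c i - ρ / 2, fun i => c i + ρ / 2, fun i => by linarith⟩
  have hI0 : IsCube I0 ρ := ⟨hρ, fun i => by simp [I0]⟩
  let ctr : Box (Fin n) → Rn n := fun I => WithLp.toLp 2 fun i => (I.lower i + I.upper i) / 2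
  have hctr : ctr I0 = c := by
    ext i; simp [ctr, I0]
  let Ω : (Fin n → ℝ) → ℝ := fun x => ω (WithLp.toLp 2 x)
  let F : (Fin n → ℝ) → ℝ := fun x => f (WithLp.toLp 2 x)
  have hΩpos : ∀ x, 0 < Ω x := fun x => hpos _
  have hΩ : ∀ I : Box (Fin n), IntegrableOn Ω I := loc_int ω hloc
  have hF : ∀ I : Box (Fin n), IntegrableOn F I := loc_int f hf
  have hFm : AEMeasurable F volume :=
    hf.aestronglyMeasurable.aemeasurable.comp_quasiMeasurePreserving
      (PiLp.volume_preserving_toLp (Fin n)).quasiMeasurePreserving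
  -- side length chosen so that `I0` gets `ρ`
  let side : Box (Fin n) → ℝ := fun I =>
    if I = I0 then ρ else if h : ∃ σ, IsCube I σ then h.choose else 1
  have hside : ∀ I, (∃ σ, IsCube I σ) → IsCube I (side I) := by
    intro I h
    by_cases h1 : I = I0
    · simp only [side, h1, if_true]; exact hI0
    · simp only [side, h1, if_false, h, dif_pos]; exact h.choose_spec
  have hside0 : side I0 = ρ := by simp [side]
  have hw : ∀ I, (∃ σ, IsCube I σ) → wMeas ω (cube (ctr I) (side I)) = ∫ x in I, Ω x :=
    fun I h => int_cube (hside I h) ω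
  have hA1' : ∀ I, (∃ σ, IsCube I σ) → ∀ᵐ x, x ∈ I → (∫ x in I, Ω x) / side I ^ n ≤ A * Ω x := by
    intro I h
    have h1 := (PiLp.volume_preserving_toLp (Fin n)).quasiMeasurePreserving.ae
      (hA1 (ctr I) (side I) (hside I h).1)
    filter_upwards [h1] with x hx hxI
    rw [← hw I h]
    apply hx
    have h2 : x ∈ Box.Icc I := Box.coe_subset_Icc hxI
    rw [← preimage_cube (hside I h)] at h2
    exact h2
  have hA0 : 0 < A := by linarith
  have hw0 := int_pos hI0 Ω hΩpos (hΩ I0)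
  have main := jn_main (volume.withDensity fun x => ENNReal.ofReal (Ω x)) I0
    (by rw [m_box I0 Ω hΩpos (hΩ I0)]; exact ENNReal.ofReal_ne_top)
    (by rw [m_box I0 Ω hΩpos (hΩ I0)]; simpa using hw0)
    (ENNReal.ofReal A) (ENNReal.ofReal (1 - 1 / (2 * A))) (ENNReal.ofReal (τ * N))
    (by simpa using hA0) ENNReal.ofReal_ne_top
    (by
      have h1 : 0 ≤ 1 - 1 / (2 * A) := by
        rw [sub_nonneg, div_le_one (by positivity)]; linarith
      rw [show (2 : ℝ≥0∞) = ENNReal.ofReal 2 by simp, ← ENNReal.ofReal_mul (by norm_num),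
        ← ENNReal.ofReal_mul (by positivity), ← ENNReal.ofReal_one,
        ← ENNReal.ofReal_add (by positivity) (by norm_num)]
      congr 1
      field_simp
      ring)
    (by
      rw [← ENNReal.ofReal_one, ENNReal.ofReal_lt_ofReal_iff (by norm_num)]
      have : 0 < 1 / (2 * A) := by positivity
      linarith)
    F hFm (fun I => cQ (ctr I) (side I))
    (fun I _ h => a1_sets hA I (hside I h) Ω hΩpos (hΩ I) (hA1' I h))
    (fun I _ h => cheb hr0 hr1 hA hN hτ0 hτ I (hside I h) Ω F _ hΩpos (hΩ I) (hF I) (hA1' I h) (by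
      rw [← hw I h]
      refine le_trans (le_of_eq ?_) (hosc (ctr I) (side I) (hside I h).1)
      exact (int_cube (hside I h) (fun x => (|f x - cQ (ctr I) (side I)| / ω x) ^ r * ω x)).symm))
    ⟨ρ, hI0⟩
  have e1 : ∫ x in cube c ρ, |f x - cQ c ρ| = ∫ x in I0, ‖F x - cQ c ρ‖ := by
    have := int_cube hI0 (fun x => |f x - cQ c ρ|)
    rw [show (WithLp.toLp 2 fun i => (I0.lower i + I0.upper i) / 2) = c from hctr] at this
    exact this
  have e2 : wMeas ω (cube c ρ) = ∫ x in I0, Ω x := by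
    have := hw I0 ⟨ρ, hI0⟩
    rwa [hctr, hside0] at this
  simp only [hctr, hside0] at main
  rw [m_box I0 Ω hΩpos (hΩ I0)] at main
  have hk : IntegrableOn (fun x => F x - cQ c ρ) (I0 : Set (Fin n → ℝ)) :=
    (hF I0).sub (integrableOn_const (I0.measure_coe_lt_top volume).ne)
  rw [e1, e2, integral_norm_eq_lintegral_enorm hk.aestronglyMeasurable]
  refine ENNReal.toReal_le_of_le_ofReal (by positivity) (main.trans (le_of_eq ?_))
  rw [show (4 : ℝ≥0∞) = ENNReal.ofReal 4 by simp, ← ENNReal.ofReal_mul (by norm_num),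
    ← ENNReal.ofReal_mul (by positivity), ← ENNReal.ofReal_mul (by positivity)]
  congr 1; ring

end Helpers

/-- for `ω ∈ A₁`, `0 < r < 1` and `f` with `‖f‖_{BMO_r(ω)} ≤ N` (at the
minimizers `c_Q`), one has `(1/ω(Q)) ∫_Q |f - c_Q| ≤ C N` with `C = C(n, r, [ω]_{A₁})`. -/
theorem stmt6 (n : ℕ) (r A : ℝ) (hr0 : 0 < r) (hr1 : r < 1) (hA : 1 ≤ A) :
    ∃ C : ℝ, 0 < C ∧
      ∀ (ω f : Rn n → ℝ) (cQ : Rn n → ℝ → ℝ) (N : ℝ),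
        IsA1 ω A → LocallyIntegrable f volume → 0 ≤ N →
        -- `cQ c ρ` minimizes the `r`-oscillation over `cube c ρ`
        (∀ (c : Rn n) (ρ : ℝ), 0 < ρ → ∀ k : ℝ,
            (∫ x in cube c ρ, (|f x - cQ c ρ| / ω x) ^ r * ω x) ≤
              ∫ x in cube c ρ, (|f x - k| / ω x) ^ r * ω x) →
        -- `‖f‖_{BMO_r(ω)} ≤ N`
        (∀ (c : Rn n) (ρ : ℝ), 0 < ρ →
            (∫ x in cube c ρ, (|f x - cQ c ρ| / ω x) ^ r * ω x) ≤ N ^ r * wMeas ω (cube c ρ)) →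
        ∀ (c : Rn n) (ρ : ℝ), 0 < ρ →
          (∫ x in cube c ρ, |f x - cQ c ρ|) ≤ C * N * wMeas ω (cube c ρ) := by
  have hA0 : 0 < A := by linarith
  set τ : ℝ := (2 ^ (n + 2) * A) ^ (1 / r) with hτdef
  have hτ0 : 0 < τ := by positivity
  have hτ : 2 ^ (n + 2) * A ≤ τ ^ r := by
    rw [hτdef, ← Real.rpow_mul (by positivity), one_div_mul_cancel hr0.ne', Real.rpow_one]
  refine ⟨4 * A * τ, by positivity, ?_⟩
  intro ω f cQ N hω hf hN _ hosc c ρ hρ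
  have hw : ∀ S, 0 ≤ wMeas ω S := fun S => integral_nonneg fun x => (hω.1 x).le
  have key : ∀ δ > 0, (∫ x in cube c ρ, |f x - cQ c ρ|) ≤
      4 * A * τ * (N + δ) * wMeas ω (cube c ρ) := by
    intro δ hδ
    refine stmt6_pos n r A hr0 hr1 hA τ hτ0 hτ ω f cQ (N + δ) hω hf (by linarith) ?_ c ρ hρ
    intro c' ρ' hρ'
    refine (hosc c' ρ' hρ').trans ?_
    refine mul_le_mul_of_nonneg_right ?_ (hw _)
    exact Real.rpow_le_rpow hN (by linarith) hr0.le
  have hlim : Filter.Tendsto (fun δ : ℝ => 4 * A * τ * (N + δ) * wMeas ω (cube c ρ))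
      (nhdsWithin 0 (Set.Ioi 0)) (nhds (4 * A * τ * (N + 0) * wMeas ω (cube c ρ))) := by
    apply Filter.Tendsto.mono_left _ nhdsWithin_le_nhds
    apply Continuous.tendsto
    fun_prop
  have := ge_of_tendsto hlim (by filter_upwards [self_mem_nhdsWithin] with δ hδ using key δ hδ)
  simpa using this
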